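/- Let m and n be positive integers with m > n(1+√5)/2. Then no m×(n,m,m) triple is rigid with respect to feedback similarity. -/

import Mathlib

open Matrix

/-- An `m×(n,m)` pair: a pair `(B, A)` with `B ∈ ℂ^{m×n}` and `A ∈ ℂ^{m×m}`. -/
abbrev PairT (m n : ℕ) :=
  Matrix (Fin m) (Fin n) ℂ × Matrix (Fin m) (Fin m) ℂ

/-- Feedback similarity of `m×(n,m)` pairs: `(B,A)` and `(B',A')` are feedback similar if
`B' = S⁻¹BP` and `A' = S⁻¹(AS + BU)` for some invertible `S, P` and some `U`. -/
def FSP {m n : ℕ} (X Y : PairT m n) : Prop :=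
  ∃ (S : Matrix (Fin m) (Fin m) ℂ) (P : Matrix (Fin n) (Fin n) ℂ)
    (U : Matrix (Fin n) (Fin m) ℂ),
    IsUnit S ∧ IsUnit P ∧ Y.1 = S⁻¹ * X.1 * P ∧ Y.2 = S⁻¹ * (X.2 * S + X.1 * U)

/-- An `m×(n,m,m)` triple: a triple `(C, B, A)` with `C ∈ ℂ^{m×n}` and `B, A ∈ ℂ^{m×m}`. -/
abbrev TripleT (m n : ℕ) :=
  Matrix (Fin m) (Fin n) ℂ × Matrix (Fin m) (Fin m) ℂ × Matrix (Fin m) (Fin m) ℂ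

/-- Feedback similarity of `m×(n,m,m)` triples: `(C,B,A)` and `(C',B',A')` are feedback
similar if `C' = S⁻¹CP`, `B' = S⁻¹(BS + CV)`, `A' = S⁻¹(AS + CU)` for some invertible
`S, P` and some `U, V`. -/
def FST {m n : ℕ} (X Y : TripleT m n) : Prop :=
  ∃ (S : Matrix (Fin m) (Fin m) ℂ) (P : Matrix (Fin n) (Fin n) ℂ)
    (U V : Matrix (Fin n) (Fin m) ℂ),
    IsUnit S ∧ IsUnit P ∧ Y.1 = S⁻¹ * X.1 * P ∧
    Y.2.1 = S⁻¹ * (X.2.1 * S + X.1 * V) ∧ Y.2.2 = S⁻¹ * (X.2.2 * S + X.1 * U)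

/-- Frobenius norm of a complex matrix. -/
noncomputable def fnorm {p q : ℕ} (M : Matrix (Fin p) (Fin q) ℂ) : ℝ :=
  Real.sqrt (∑ i, ∑ j, ‖M i j‖ ^ 2)

/-- Norm of a pair: `‖(B,A)‖ = ‖B‖ + ‖A‖`. -/
noncomputable def pnorm {m n : ℕ} (X : PairT m n) : ℝ := fnorm X.1 + fnorm X.2

/-- Norm of a triple: `‖(C,B,A)‖ = ‖C‖ + ‖B‖ + ‖A‖`. -/
noncomputable def tnorm {m n : ℕ} (X : TripleT m n) : ℝ :=
  fnorm X.1 + fnorm X.2.1 + fnorm X.2.2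

/-- A triple is rigid with respect to feedback similarity if all triples in some
`ε`-neighbourhood of it are feedback similar to it. -/
def RigidT {m n : ℕ} (X : TripleT m n) : Prop :=
  ∃ ε : ℝ, 0 < ε ∧ ∀ Y : TripleT m n, tnorm (Y - X) < ε → FST Y X

section Helper

attribute [local instance] Matrix.normedAddCommGroup Matrix.normedSpace

theorem cd_entry {E : Type*} [NormedAddCommGroup E] [NormedSpace ℝ E] {p q : ℕ}
    {f : E → Matrix (Fin p) (Fin q) ℂ} (hf : ContDiff ℝ 1 f) (i : Fin p) (j : Fin q) :
    ContDiff ℝ 1 (fun x => f x i j) :=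
  contDiff_pi.1 (contDiff_pi.1 hf i) j

theorem cd_of_entry {E : Type*} [NormedAddCommGroup E] [NormedSpace ℝ E] {p q : ℕ}
    {f : E → Matrix (Fin p) (Fin q) ℂ} (hf : ∀ i j, ContDiff ℝ 1 (fun x => f x i j)) :
    ContDiff ℝ 1 f :=
  contDiff_pi.2 fun i => contDiff_pi.2 fun j => hf i j

theorem cd_mul {E : Type*} [NormedAddCommGroup E] [NormedSpace ℝ E] {p q r : ℕ}
    {f : E → Matrix (Fin p) (Fin q) ℂ} {g : E → Matrix (Fin q) (Fin r) ℂ}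
    (hf : ContDiff ℝ 1 f) (hg : ContDiff ℝ 1 g) :
    ContDiff ℝ 1 (fun x => f x * g x) := by
  refine cd_of_entry fun i j => ?_
  simp only [Matrix.mul_apply]
  exact ContDiff.sum fun k _ => (cd_entry hf i k).mul (cd_entry hg k j)

theorem cd_adj {E : Type*} [NormedAddCommGroup E] [NormedSpace ℝ E] {p : ℕ}
    {f : E → Matrix (Fin p) (Fin p) ℂ} (hf : ContDiff ℝ 1 f) :
    ContDiff ℝ 1 (fun x => (f x).adjugate) := by
  refine cd_of_entry fun i j => ?_
  simp only [Matrix.adjugate_apply, Matrix.det_apply']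
  refine ContDiff.sum fun k _ => contDiff_const.mul (contDiff_prod fun l _ => ?_)
  by_cases hl : k l = j
  · simp only [hl, Matrix.updateRow_self]
    exact contDiff_const
  · simp only [Matrix.updateRow_ne hl]
    exact cd_entry hf _ _

theorem cont_fnorm {p q : ℕ} :
    Continuous (fnorm : Matrix (Fin p) (Fin q) ℂ → ℝ) := by
  unfold fnorm
  fun_prop

theorem cont_tnorm {m n : ℕ} : Continuous (tnorm : TripleT m n → ℝ) := by
  unfold tnorm
  exact ((cont_fnorm.comp continuous_fst).add
    (cont_fnorm.comp (continuous_fst.comp continuous_snd))).add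
    (cont_fnorm.comp (continuous_snd.comp continuous_snd))

/-- Parameter space. -/
abbrev ParamT (m n : ℕ) :=
  Matrix (Fin m) (Fin m) ℂ × Matrix (Fin n) (Fin n) ℂ ×
    Matrix (Fin n) (Fin m) ℂ × Matrix (Fin n) (Fin m) ℂ

/-- Polynomial parametrization of the orbit of `T`. -/
noncomputable def orbMap {m n : ℕ} (T : TripleT m n) (x : ParamT m n) : TripleT m n :=
  (x.1 * T.1 * x.2.1, x.1 * (T.2.1 + T.1 * x.2.2.1) * x.1.adjugate,
    x.1 * (T.2.2 + T.1 * x.2.2.2) * x.1.adjugate)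

theorem cd_orbMap {m n : ℕ} (T : TripleT m n) : ContDiff ℝ 1 (orbMap T) := by
  have h1 : ContDiff ℝ 1 (fun x : ParamT m n => x.1) := contDiff_fst
  have h2 : ContDiff ℝ 1 (fun x : ParamT m n => x.2.1) := contDiff_fst.comp contDiff_snd
  have h3 : ContDiff ℝ 1 (fun x : ParamT m n => x.2.2.1) :=
    contDiff_fst.comp (contDiff_snd.comp contDiff_snd)
  have h4 : ContDiff ℝ 1 (fun x : ParamT m n => x.2.2.2) :=
    contDiff_snd.comp (contDiff_snd.comp contDiff_snd)
  unfold orbMap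
  exact (cd_mul (cd_mul h1 contDiff_const) h2).prodMk
    ((cd_mul (cd_mul h1 (contDiff_const.add (cd_mul contDiff_const h3))) (cd_adj h1)).prodMk
    (cd_mul (cd_mul h1 (contDiff_const.add (cd_mul contDiff_const h4))) (cd_adj h1)))

theorem orb_of_FST {m n : ℕ} (hm : 0 < m) {Y T : TripleT m n} (h : FST Y T) :
    Y ∈ Set.range (orbMap T) := by
  obtain ⟨S, P, U, V, hS, hP, h1, h2, h3⟩ := h
  have hSd : IsUnit S.det := (Matrix.isUnit_iff_isUnit_det _).1 hS
  have hPd : IsUnit P.det := (Matrix.isUnit_iff_isUnit_det _).1 hP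
  obtain ⟨c, hc⟩ := IsAlgClosed.exists_pow_nat_eq (S.det) hm
  have hc0 : c ≠ 0 := by
    rintro rfl
    rw [zero_pow hm.ne'] at hc
    exact hSd.ne_zero hc.symm
  have hadj : (c⁻¹ • S).adjugate = c • S⁻¹ := by
    have hd : (c⁻¹ • S).det = 1 := by
      rw [Matrix.det_smul, Fintype.card_fin, ← hc, ← mul_pow, inv_mul_cancel₀ hc0, one_pow]
    have h5 : (c⁻¹ • S)⁻¹ = (c⁻¹ • S).adjugate := by
      rw [Matrix.inv_def, hd]; simp
    rw [← h5]
    apply Matrix.inv_eq_right_inv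
    rw [Matrix.smul_mul, Matrix.mul_smul, smul_smul, inv_mul_cancel₀ hc0, one_smul,
      Matrix.mul_nonsing_inv _ hSd]
  have hC : S * T.1 * P⁻¹ = Y.1 := by
    rw [h1, Matrix.mul_assoc S⁻¹, Matrix.mul_nonsing_inv_cancel_left _ _ hSd,
      Matrix.mul_nonsing_inv_cancel_right _ _ hPd]
  have hT : T.1 * P⁻¹ = S⁻¹ * Y.1 := by
    rw [← hC, Matrix.mul_assoc S, Matrix.nonsing_inv_mul_cancel_left _ _ hSd]
  have key : ∀ (M N : Matrix (Fin m) (Fin m) ℂ) (W : Matrix (Fin n) (Fin m) ℂ),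
      N = S⁻¹ * (M * S + Y.1 * W) →
      (c⁻¹ • S) * (N + T.1 * (-(P⁻¹ * W))) * (c • S⁻¹) = M := by
    intro M N W hN
    have : N + T.1 * (-(P⁻¹ * W)) = S⁻¹ * (M * S) := by
      rw [Matrix.mul_neg, ← Matrix.mul_assoc, hT, hN, Matrix.mul_add, Matrix.mul_assoc S⁻¹ Y.1]
      abel
    rw [this, Matrix.smul_mul, Matrix.smul_mul, Matrix.mul_smul, smul_smul,
      inv_mul_cancel₀ hc0, one_smul, Matrix.mul_nonsing_inv_cancel_left _ _ hSd,
      Matrix.mul_nonsing_inv_cancel_right _ _ hSd]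
  refine ⟨(c⁻¹ • S, c • P⁻¹, -(P⁻¹ * V), -(P⁻¹ * U)), ?_⟩
  simp only [orbMap, hadj]
  refine Prod.ext ?_ (Prod.ext (key _ _ _ h2) (key _ _ _ h3))
  simp only
  rw [Matrix.smul_mul, Matrix.smul_mul, Matrix.mul_smul, smul_smul, inv_mul_cancel₀ hc0,
    one_smul, hC]

theorem not_rigid_aux {m n : ℕ} (hm : 0 < m) (hlt : n * n + m * n < m * m)
    (T : TripleT m n) : ¬ RigidT T := by
  rintro ⟨ε, hε, H⟩
  have hfr : Module.finrank ℝ (ParamT m n) < Module.finrank ℝ (TripleT m n) := by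
    simp only [Module.finrank_prod, Module.finrank_matrix, Fintype.card_fin,
      Complex.finrank_real_complex]
    nlinarith
  have hd := (cd_orbMap T).dense_compl_range_of_finrank_lt_finrank hfr
  have ho : IsOpen {Y : TripleT m n | tnorm (Y - T) < ε} :=
    isOpen_lt (cont_tnorm.comp (continuous_id.sub continuous_const)) continuous_const
  have hne : ({Y : TripleT m n | tnorm (Y - T) < ε}).Nonempty :=
    ⟨T, by simpa [tnorm, fnorm] using hε⟩
  obtain ⟨Y, hY, hY'⟩ := hd.inter_open_nonempty _ ho hne
  exact hY' (orb_of_FST hm (H Y hY))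

end Helper

/-- Theorem 11(b) of the paper: if `m > n(1+√5)/2`, then no
`m×(n,m,m)` triple is rigid. -/
theorem stmt12 (m n : ℕ) (hm : 0 < m) (hn : 0 < n)
    (h : (n:ℝ) * (1 + Real.sqrt 5) / 2 < (m:ℝ)) :
    ∀ T : TripleT m n, ¬ RigidT T := by
  refine not_rigid_aux hm ?_
  have hn' : (0:ℝ) < n := by exact_mod_cast hn
  have h5 := Real.sq_sqrt (show (0:ℝ) ≤ 5 by norm_num)
  have h50 := Real.sqrt_nonneg 5
  have h1 : (n:ℝ) * Real.sqrt 5 < 2 * m - n := by linarith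
  have h2 : ((n:ℝ) * Real.sqrt 5) ^ 2 < (2 * m - n) ^ 2 :=
    pow_lt_pow_left₀ h1 (by positivity) (by norm_num)
  rw [mul_pow, h5] at h2
  have : (n:ℝ) * n + m * n < m * m := by nlinarith
  exact_mod_cast this
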